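/- arXiv:2310.04391 — 4 statements merged into one kernel-verified Lean document; each statement's English description precedes it below -/
import Mathlib

section
/- Let G be a finite simple graph on n vertices with adjacency matrix A, let Ḡ be its complement with adjacency matrix Ā, let P_G and P_{Ḡ} denote the characteristic polynomials of A and Ā, and let j be the all-ones vector. Then for every real number z ≠ 0 with P_G(1/z) ≠ 0, the matrix I − z·A is invertible and jᵀ (I − z·A)⁻¹ j = (1/z) · ( (−1)ⁿ · P_{Ḡ}(−1/z − 1) / P_G(1/z) − 1 ). (Equivalently, the walk generating function W_G(z) = Σ_k w_k(G) z^k satisfies Cvetković's formula W_G(z) = (1/z)((−1)ⁿ P_{Ḡ}(−1/z−1)/P_G(1/z) − 1).) -/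
/-- **Cvetković's formula.** For a graph `G` on `n` vertices with
adjacency matrix `A`, complement `Ḡ`, and every real `z ≠ 0` with `P_G(1/z) ≠ 0`,
the matrix `I - z•A` is invertible and
`jᵀ (I - z•A)⁻¹ j = (1/z) ((-1)ⁿ P_Ḡ(-1/z - 1)/P_G(1/z) - 1)`. -/
theorem cvetkovic_formula {V : Type*} [Fintype V] [DecidableEq V]
    (G : SimpleGraph V) [DecidableRel G.Adj] (n : ℕ) (hn : Fintype.card V = n)
    (z : ℝ) (hz : z ≠ 0)
    (hP : ((G.adjMatrix ℝ).charpoly).eval (1 / z) ≠ 0) :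
    IsUnit (1 - z • G.adjMatrix ℝ) ∧
      ∑ x, ∑ y, ((1 - z • G.adjMatrix ℝ)⁻¹) x y =
        (1 / z) * ((-1 : ℝ) ^ n * ((Gᶜ.adjMatrix ℝ).charpoly).eval (-1 / z - 1) /
          ((G.adjMatrix ℝ).charpoly).eval (1 / z) - 1) := by
  subst hn
  set A := G.adjMatrix ℝ with hA
  set M : Matrix V V ℝ := 1 - z • A with hM
  have h1 : (A.charpoly).eval (1 / z) = (1 / z) ^ Fintype.card V * M.det := by
    rw [Matrix.eval_charpoly, ← Matrix.det_smul]
    congr 1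
    ext i k
    simp only [hM, Matrix.sub_apply, Matrix.smul_apply, Matrix.scalar_apply,
      Matrix.diagonal_apply, Matrix.one_apply, smul_eq_mul]
    split_ifs <;> field_simp <;> ring
  have h2 : ((Gᶜ.adjMatrix ℝ).charpoly).eval (-1 / z - 1) = (-(1 / z)) ^ Fintype.card V *
      (M + Matrix.replicateCol Unit (fun _ : V => z) *
        Matrix.replicateRow Unit (fun _ : V => (1 : ℝ))).det := by
    rw [Matrix.eval_charpoly, ← Matrix.det_smul]
    congr 1
    ext i k
    by_cases hik : i = k
    · subst hik
      simp [hM, hA, Matrix.mul_apply]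
      field_simp
      ring
    · by_cases hadj : G.Adj i k
      · simp [hM, hA, Matrix.mul_apply, Matrix.one_apply, hik, hadj]
      · simp [hM, hA, Matrix.mul_apply, Matrix.one_apply, hik, hadj]
        try field_simp
  have hdet : M.det ≠ 0 := by
    intro h
    exact hP (by rw [h1, h, mul_zero])
  have hu : IsUnit M.det := isUnit_iff_ne_zero.mpr hdet
  refine ⟨(Matrix.isUnit_iff_isUnit_det M).mpr hu, ?_⟩
  rw [h1, h2, Matrix.det_add_replicateCol_mul_replicateRow hu]
  have h3 : (1 + Matrix.replicateRow Unit (fun _ : V => (1 : ℝ)) * M⁻¹ *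
      Matrix.replicateCol Unit (fun _ : V => z)).det = 1 + z * ∑ x, ∑ y, M⁻¹ x y := by
    rw [Matrix.det_unique]
    simp only [Matrix.add_apply, Matrix.one_apply_eq, Matrix.mul_apply,
      Matrix.replicateRow_apply, Matrix.replicateCol_apply, one_mul]
    rw [← Finset.sum_mul, Finset.sum_comm, mul_comm]
  rw [h3]
  have h4 : (-(1 / z)) ^ Fintype.card V = (-1) ^ Fintype.card V * (1 / z) ^ Fintype.card V := by
    rw [← mul_pow]; ring
  have h5 : ((-1 : ℝ)) ^ Fintype.card V * (-1) ^ Fintype.card V = 1 := by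
    rw [← mul_pow]; simp
  have h6 : (1 / z) ^ Fintype.card V ≠ 0 := pow_ne_zero _ (one_div_ne_zero hz)
  have h7 : (-1 : ℝ) ^ Fintype.card V * ((-(1 / z)) ^ Fintype.card V *
      (M.det * (1 + z * ∑ x, ∑ y, M⁻¹ x y))) / ((1 / z) ^ Fintype.card V * M.det)
      = 1 + z * ∑ x, ∑ y, M⁻¹ x y := by
    rw [div_eq_iff (mul_ne_zero h6 hdet), h4]
    linear_combination ((1 / z) ^ Fintype.card V * M.det *
      (1 + z * ∑ x, ∑ y, M⁻¹ x y)) * h5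
  rw [h7]
  field_simp
  ring
end

section
/- Let G and H be finite simple graphs such that the characteristic polynomials of their adjacency matrices are equal and the characteristic polynomials of the adjacency matrices of their complements Ḡ and H̄ are equal (i.e., G and H have the same generalized spectrum). Then for every natural number k, the total walk counts agree: w_k(G) = w_k(H). (In the paper's notation: MEA ⪯ GenSpec.) -/
open Matrix in
theorem aux_inv {V : Type*} [Fintype V] [DecidableEq V] (A : Matrix V V ℝ) :
    (1 - (PowerSeries.X : PowerSeries ℝ) • A.map (PowerSeries.C (R := ℝ))) *
      (Matrix.of fun i j => PowerSeries.mk fun k => (A ^ k) i j) = 1 := by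
  rw [sub_mul, one_mul, smul_mul_assoc]
  ext i j k
  cases k with
  | zero =>
    simp [Matrix.one_apply, apply_ite]
  | succ k =>
    simp [Matrix.mul_apply, Matrix.one_apply, apply_ite, PowerSeries.coeff_succ_X_mul, pow_succ', PowerSeries.coeff_one]

open Matrix in
theorem aux_rev {V : Type*} [Fintype V] [DecidableEq V] (A : Matrix V V ℝ) :
    ((A.charpolyRev : Polynomial ℝ) : PowerSeries ℝ) =
      det (1 - (PowerSeries.X : PowerSeries ℝ) • A.map (PowerSeries.C (R := ℝ))) := by
  rw [charpolyRev, ← Polynomial.coeToPowerSeries.ringHom_apply, RingHom.map_det]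
  congr 1
  ext1 i j
  simp [Matrix.one_apply, apply_ite]
  exact mul_comm _ _

open Matrix in
theorem aux_main {V : Type*} [Fintype V] [DecidableEq V] (A : Matrix V V ℝ) :
    (((A - Matrix.of fun _ _ => (1:ℝ)).charpolyRev : Polynomial ℝ) : PowerSeries ℝ) =
     (A.charpolyRev : PowerSeries ℝ) *
      (1 + PowerSeries.X * PowerSeries.mk fun k => ∑ x, ∑ y, (A ^ k) x y) := by
  rw [aux_rev, aux_rev]
  set M := (1 - (PowerSeries.X : PowerSeries ℝ) • A.map (PowerSeries.C (R := ℝ))) with hM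
  set N : Matrix V V (PowerSeries ℝ) := (Matrix.of fun i j => PowerSeries.mk fun k => (A ^ k) i j) with hN
  have h : M * N = 1 := aux_inv A
  let U : Matrix V Unit (PowerSeries ℝ) := Matrix.of fun _ _ => PowerSeries.X
  let T : Matrix Unit V (PowerSeries ℝ) := Matrix.of fun _ _ => 1
  have e : (1 - (PowerSeries.X : PowerSeries ℝ) • (A - Matrix.of fun _ _ => (1:ℝ)).map (PowerSeries.C (R := ℝ)))
     = M * (1 + (N * U) * T) := by
    rw [mul_add, mul_one, ← Matrix.mul_assoc, ← Matrix.mul_assoc, h, Matrix.one_mul, hM]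
    ext1 i j
    simp [U, T, Matrix.mul_apply, mul_sub]
    ring
  rw [e, det_mul, det_one_add_mul_comm]
  congr 1
  simp only [det_unique, Matrix.add_apply, Matrix.one_apply_eq]
  congr 1
  have : (PowerSeries.mk fun k => ∑ x, ∑ y, (A ^ k) x y) = ∑ x, ∑ y, N x y := by
    ext k
    simp [hN]
  rw [this]
  simp [U, T, Matrix.mul_apply, Finset.mul_sum, mul_comm]

open Matrix in
theorem aux_compl {V : Type*} [Fintype V] [DecidableEq V] (G : SimpleGraph V) [DecidableRel G.Adj] (y : ℝ) :
    (G.adjMatrix ℝ - Matrix.of fun _ _ => (1:ℝ)).charpoly.eval y =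
      (-1) ^ (Fintype.card V) * (Gᶜ.adjMatrix ℝ).charpoly.eval (-1 - y) := by
  rw [eval_charpoly, eval_charpoly, ← det_neg]
  congr 1
  ext i j
  by_cases h : i = j
  · subst h; simp; try ring
  · by_cases h' : G.Adj i j <;> simp [h, h', SimpleGraph.adjMatrix_apply, Matrix.scalar_apply]

theorem genspec_determines_total_walks
    {V W : Type*} [Fintype V] [DecidableEq V] [Fintype W] [DecidableEq W]
    (G : SimpleGraph V) [DecidableRel G.Adj] (H : SimpleGraph W) [DecidableRel H.Adj]
    (h1 : (G.adjMatrix ℝ).charpoly = (H.adjMatrix ℝ).charpoly)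
    (h2 : (Gᶜ.adjMatrix ℝ).charpoly = (Hᶜ.adjMatrix ℝ).charpoly) :
    ∀ k : ℕ, ∑ x, ∑ y, ((G.adjMatrix ℝ) ^ k) x y = ∑ x, ∑ y, ((H.adjMatrix ℝ) ^ k) x y := by
  intro k
  have hc : Fintype.card V = Fintype.card W := by
    rw [← Matrix.charpoly_natDegree_eq_dim (G.adjMatrix ℝ), h1, Matrix.charpoly_natDegree_eq_dim]
  have h3 : (G.adjMatrix ℝ - Matrix.of fun _ _ => (1:ℝ)).charpoly =
      (H.adjMatrix ℝ - Matrix.of fun _ _ => (1:ℝ)).charpoly := by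
    apply Polynomial.funext
    intro y
    rw [aux_compl, aux_compl, h2, hc]
  have mG := aux_main (G.adjMatrix ℝ)
  have mH := aux_main (H.adjMatrix ℝ)
  rw [← Matrix.reverse_charpoly, ← Matrix.reverse_charpoly, h3, h1, Matrix.reverse_charpoly,
    Matrix.reverse_charpoly, mH] at mG
  have hne : ((H.adjMatrix ℝ).charpolyRev : PowerSeries ℝ) ≠ 0 := by
    intro h0
    have := (Polynomial.coe_eq_zero_iff).1 h0
    rw [← Matrix.reverse_charpoly, Polynomial.reverse_eq_zero] at this
    exact (Matrix.charpoly_monic _).ne_zero this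
  have h4 := add_left_cancel (mul_left_cancel₀ hne mG)
  have h5 := congrArg (PowerSeries.coeff (k+1)) h4
  simpa [PowerSeries.coeff_succ_X_mul] using h5.symm
end

section
/- There exist finite simple graphs G and H such that w⁽¹ᐟ²⁾(G) = w⁽¹ᐟ²⁾(H) but w⁽¹⁾(G) ≠ w⁽¹⁾(H). (Equivalently, by the walk-count characterization, Fürer's weak spectral invariant coincides on G and H while Fürer's strong spectral invariant distinguishes them; hence the weak spectral invariant is strictly weaker than the strong one.) -/
/-- The walk count `w_k(x,y)`: the number of walks of length `k` from `x` to `y`,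
i.e. the `(x,y)` entry of the `k`-th power of the adjacency matrix. -/
def walkFun {V : Type*} [Fintype V] [DecidableEq V]
    (G : SimpleGraph V) [DecidableRel G.Adj] (x y : V) : ℕ → ℕ :=
  fun k => (G.adjMatrix ℕ ^ k) x y

/-- `w⁽¹ᐟ²⁾(G)`: the multiset, over vertices `x`, of the pairs consisting of
`k ↦ w_k(x,x)` together with the multiset, over vertices `y`, of `k ↦ w_k(x,y)`. -/
def wHalf {V : Type*} [Fintype V] [DecidableEq V]
    (G : SimpleGraph V) [DecidableRel G.Adj] : Multiset ((ℕ → ℕ) × Multiset (ℕ → ℕ)) :=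
  (Finset.univ : Finset V).val.map fun x =>
    (walkFun G x x, (Finset.univ : Finset V).val.map fun y => walkFun G x y)

/-- `w⁽¹⁾(G)`: the multiset, over vertices `x`, of the pairs consisting of
`k ↦ w_k(x,x)` together with the multiset, over vertices `y`, of the pairs
`(k ↦ w_k(x,y), k ↦ w_k(y,y))`. -/
def wOne {V : Type*} [Fintype V] [DecidableEq V]
    (G : SimpleGraph V) [DecidableRel G.Adj] :
    Multiset ((ℕ → ℕ) × Multiset ((ℕ → ℕ) × (ℕ → ℕ))) :=
  (Finset.univ : Finset V).val.map fun x =>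
    (walkFun G x x,
      (Finset.univ : Finset V).val.map fun y => (walkFun G x y, walkFun G y y))

/-- 2-regular graphs on six vertices: `C₆` (`false`) and `2 K₃` (`true`). -/
def ringAdj (b : Bool) (i j : Fin 6) : Bool :=
  if b then decide (j = i + 2 ∨ i = j + 2) else decide (j = i + 1 ∨ i = j + 1)

/-- Vertices: component, side of the join, vertex in the side. -/
abbrev JV := Bool × Bool × Fin 6

/-- Adjacency in the disjoint union of two joins; `t c s` is the type of side `s`
of component `c`. -/
def joinAdj (t : Bool → Bool → Bool) (x y : JV) : Bool :=
  (x.1 == y.1) && (if x.2.1 = y.2.1 then ringAdj (t x.1 x.2.1) x.2.2 y.2.2 else true)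

theorem ringAdj_symm : ∀ b i j, ringAdj b i j = ringAdj b j i := by decide

theorem ringAdj_irrefl : ∀ b i, ringAdj b i i = false := by decide

def joinGraph (t : Bool → Bool → Bool) : SimpleGraph JV where
  Adj x y := joinAdj t x y = true
  symm := ⟨by
    rintro ⟨c, s, i⟩ ⟨c', s', j⟩ h
    simp only [joinAdj, Bool.and_eq_true, beq_iff_eq] at h ⊢
    obtain ⟨rfl, h⟩ := h
    refine ⟨rfl, ?_⟩
    by_cases hs : s = s'
    · subst hs
      simpa [ringAdj_symm _ j i] using h
    · simp [Ne.symm hs]⟩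
  loopless := ⟨by
    rintro ⟨c, s, i⟩ h
    simp [joinAdj, ringAdj_irrefl] at h⟩

instance (t : Bool → Bool → Bool) : DecidableRel (joinGraph t).Adj :=
  fun x y => inferInstanceAs (Decidable (joinAdj t x y = true))

def ringMat (b : Bool) : Matrix (Fin 6) (Fin 6) ℕ :=
  fun i j => if ringAdj b i j = true then 1 else 0

/-- Coefficients of the all-ones blocks in the powers of the adjacency matrix. -/
def coef : ℕ → ℕ × ℕ
  | 0 => (0, 0)
  | k + 1 => (2 * (coef k).1 + 6 * (coef k).2, 2 ^ k + 6 * (coef k).1 + 2 * (coef k).2)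

theorem ringMat_col (b : Bool) (j : Fin 6) : ∑ l, ringMat b l j = 2 := by
  revert b j; decide

theorem ringMat_row (b : Bool) (j : Fin 6) : ∑ l, ringMat b j l = 2 := by
  revert b j; decide

theorem ringMat_pow_row (b : Bool) (k : ℕ) (i : Fin 6) :
    ∑ l, (ringMat b ^ k) i l = 2 ^ k := by
  induction k with
  | zero => simp [Matrix.one_apply]
  | succ k ih =>
    simp only [pow_succ, Matrix.mul_apply]
    rw [Finset.sum_comm]
    simp only [← Finset.mul_sum, ringMat_row, ← Finset.sum_mul, ih]

/-- Closed form of the walk counts. -/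
def closedForm (t : Bool → Bool → Bool) (k : ℕ) (x y : JV) : ℕ :=
  if x.1 = y.1 then
    if x.2.1 = y.2.1 then (ringMat (t x.1 x.2.1) ^ k) x.2.2 y.2.2 + (coef k).1
    else (coef k).2
  else 0

theorem joinGraph_pow (t : Bool → Bool → Bool) (k : ℕ) (x y : JV) :
    ((joinGraph t).adjMatrix ℕ ^ k) x y = closedForm t k x y := by
  induction k generalizing x y with
  | zero =>
    obtain ⟨c, s, i⟩ := x
    obtain ⟨c', s', j⟩ := y
    by_cases hc : c = c' <;> by_cases hs : s = s' <;>
      simp [closedForm, coef, Matrix.one_apply, hc, hs]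
  | succ k ih =>
    obtain ⟨c, s, i⟩ := x
    obtain ⟨c', s', j⟩ := y
    rw [pow_succ, Matrix.mul_apply]
    have hA : ∀ z w : JV, (joinGraph t).adjMatrix ℕ z w =
        if z.1 = w.1 then (if z.2.1 = w.2.1 then ringMat (t z.1 z.2.1) z.2.2 w.2.2 else 1)
        else 0 := by
      rintro ⟨a, b, l⟩ ⟨a', b', l'⟩
      rw [SimpleGraph.adjMatrix_apply]
      change (if joinAdj t _ _ = true then 1 else 0) = _
      by_cases ha : a = a' <;> by_cases hb : b = b' <;> simp [joinAdj, ha, hb, ringMat]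
    simp only [ih, hA, Fintype.sum_prod_type, Fintype.sum_bool]
    have e1 : ∀ b : Bool, ∑ l, ((ringMat b ^ k) i l + (coef k).1) * ringMat b l j
        = (ringMat b ^ (k+1)) i j + 2 * (coef k).1 := by
      intro b
      simp only [add_mul, Finset.sum_add_distrib, ← Finset.mul_sum, ringMat_col, pow_succ,
        Matrix.mul_apply]
      ring
    have e2 : ∀ b : Bool, ∑ l, (coef k).2 * ringMat b l j = 2 * (coef k).2 := by
      intro b
      rw [← Finset.mul_sum, ringMat_col, mul_comm]
    have e3 : ∀ b : Bool, ∑ l, ((ringMat b ^ k) i l + (coef k).1) = 2 ^ k + 6 * (coef k).1 := by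
      intro b
      simp [Finset.sum_add_distrib, ringMat_pow_row]
    cases c <;> cases s <;> cases c' <;> cases s' <;>
      simp [closedForm, e1, e2, e3, coef] <;> ring

noncomputable def eqv : Fin 24 ≃ JV := Fintype.equivOfCardEq (by simp)

noncomputable def finGraph (t : Bool → Bool → Bool) : SimpleGraph (Fin 24) := (joinGraph t).comap eqv

noncomputable instance (t : Bool → Bool → Bool) : DecidableRel (finGraph t).Adj :=
  fun x y => inferInstanceAs (Decidable ((joinGraph t).Adj (eqv x) (eqv y)))

theorem walkFun_finGraph (t : Bool → Bool → Bool) (x y : Fin 24) :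
    walkFun (finGraph t) x y = fun k => closedForm t k (eqv x) (eqv y) := by
  funext k
  rw [← joinGraph_pow]
  unfold walkFun
  induction k generalizing x y with
  | zero => simp [Matrix.one_apply]
  | succ k ih =>
    rw [pow_succ, pow_succ, Matrix.mul_apply, Matrix.mul_apply]
    rw [← Equiv.sum_comp eqv]
    refine Finset.sum_congr rfl fun z _ => ?_
    rw [ih]
    congr 1

def tG : Bool → Bool → Bool := fun c _ => c
def tH : Bool → Bool → Bool := fun c s => c ^^ s

def phi : JV ≃ JV where
  toFun x := (x.1 ^^ x.2.1, x.2.1, x.2.2)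
  invFun x := (x.1 ^^ x.2.1, x.2.1, x.2.2)
  left_inv := by rintro ⟨c, s, i⟩; simp
  right_inv := by rintro ⟨c, s, i⟩; simp

def psi (b : Bool) : JV ≃ JV where
  toFun x := (x.1 ^^ b, x.2)
  invFun x := (x.1 ^^ b, x.2)
  left_inv := by rintro ⟨c, s, i⟩; simp
  right_inv := by rintro ⟨c, s, i⟩; simp

theorem closedForm_psi (k : ℕ) (x y : JV) :
    closedForm tG k x y = closedForm tH k (phi x) (psi x.2.1 y) := by
  obtain ⟨c, s, i⟩ := x
  obtain ⟨c', s', j⟩ := y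
  cases c <;> cases s <;> cases c' <;> cases s' <;> rfl

theorem map_univ_equiv {α β γ : Type*} [Fintype α] [Fintype β] (e : α ≃ β) (f : β → γ) :
    (Finset.univ : Finset α).val.map (fun x => f (e x)) = (Finset.univ : Finset β).val.map f := by
  rw [← Finset.univ_map_equiv_to_embedding e, Finset.map_val, Multiset.map_map]
  rfl

theorem wHalf_finGraph (t : Bool → Bool → Bool) :
    wHalf (finGraph t) = (Finset.univ : Finset JV).val.map fun x =>
      ((fun k => closedForm t k x x),
        (Finset.univ : Finset JV).val.map fun y => fun k => closedForm t k x y) := by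
  unfold wHalf
  simp only [walkFun_finGraph]
  rw [← map_univ_equiv eqv]
  refine Multiset.map_congr rfl fun x _ => ?_
  rw [← map_univ_equiv eqv]

theorem ring_cube : ∀ b i, (ringMat b ^ 3) i i = if b then 2 else 0 := by
  intro b i
  simp only [pow_succ, pow_zero, one_mul, Matrix.mul_apply]
  revert b i
  decide

theorem closedForm_three (t : Bool → Bool → Bool) (x : JV) :
    closedForm t 3 x x = (if t x.1 x.2.1 then 2 else 0) + (coef 3).1 := by
  simp [closedForm, ring_cube]

/-- There exist finite simple graphs with `w⁽¹ᐟ²⁾(G) = w⁽¹ᐟ²⁾(H)`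
but `w⁽¹⁾(G) ≠ w⁽¹⁾(H)`: Fürer's weak spectral invariant is strictly weaker than
the strong one. -/
theorem exists_wHalf_eq_wOne_ne :
    ∃ (n m : ℕ) (G : SimpleGraph (Fin n)) (H : SimpleGraph (Fin m))
      (dG : DecidableRel G.Adj) (dH : DecidableRel H.Adj),
      @wHalf (Fin n) _ _ G dG = @wHalf (Fin m) _ _ H dH ∧
        @wOne (Fin n) _ _ G dG ≠ @wOne (Fin m) _ _ H dH := by
  refine ⟨24, 24, finGraph tG, finGraph tH, inferInstance, inferInstance, ?_, ?_⟩
  · rw [wHalf_finGraph, wHalf_finGraph]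
    refine Eq.trans ?_ (map_univ_equiv phi _)
    refine Multiset.map_congr rfl fun x _ => ?_
    refine Prod.ext ?_ ?_
    · funext k
      exact closedForm_psi k x x
    · refine Eq.trans ?_ (map_univ_equiv (psi x.2.1) _)
      dsimp only
      refine Multiset.map_congr rfl fun y _ => ?_
      funext k
      exact closedForm_psi k x y
  · intro h
    unfold wOne at h
    simp only [walkFun_finGraph] at h
    have hx := Multiset.mem_map_of_mem
      (fun x => ((fun k => closedForm tG k (eqv x) (eqv x)),
        (Finset.univ : Finset (Fin 24)).val.map fun y =>
          ((fun k => closedForm tG k (eqv x) (eqv y)), fun k => closedForm tG k (eqv y) (eqv y))))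
      (Finset.mem_univ_val (0 : Fin 24))
    rw [h] at hx
    obtain ⟨x', -, hx'⟩ := Multiset.mem_map.1 hx
    obtain ⟨h1, h2⟩ := Prod.ext_iff.1 hx'
    obtain ⟨y', hy'⟩ := eqv.surjective ((eqv x').1, !(eqv x').2.1, (eqv x').2.2)
    have hy := Multiset.mem_map_of_mem
      (fun y => ((fun k => closedForm tH k (eqv x') (eqv y)),
        fun k => closedForm tH k (eqv y) (eqv y))) (Finset.mem_univ_val y')
    dsimp only at h1 h2 hy
    rw [h2] at hy
    obtain ⟨y, -, hy2⟩ := Multiset.mem_map.1 hy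
    obtain ⟨h3, h4⟩ := Prod.ext_iff.1 hy2
    have a1 := congrFun h1 3
    have a3 := congrFun h3 1
    have a4 := congrFun h4 3
    dsimp only at a1 a3 a4
    rw [closedForm_three, closedForm_three] at a1 a4
    rw [hy'] at a3 a4
    have hc : (eqv 0).1 = (eqv y).1 := by
      by_contra hne
      simp [closedForm, hne, coef] at a3
    simp only [tG, tH, ← hc] at a1 a4
    revert a1 a4
    generalize (eqv 0).1 = b
    generalize (eqv x').1 = c
    generalize (eqv x').2.1 = s
    cases b <;> cases c <;> cases s <;> simp
end

section
/- There exist trees T and T' on 19 vertices each (finite connected acyclic simple graphs) such that w⁽⁰⁾(T) = w⁽⁰⁾(T') (so, by the walk-count characterization, T and T' have the same eigenvalues and angles), yet w_k(T) ≠ w_k(T') for some natural number k; that is, the eigenvalue–angle invariant does not determine the main eigenvalues and main angles. -/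
/-- The walk count `w_k(x,y)`: the `(x,y)` entry of the `k`-th power of the
adjacency matrix, i.e. the number of `k`-walks from `x` to `y`. -/
noncomputable def walkFunC {V : Type*} [Fintype V] [DecidableEq V]
    (G : SimpleGraph V) (x y : V) : ℕ → ℕ :=
  letI := Classical.decRel G.Adj
  fun k => (G.adjMatrix ℕ ^ k) x y

/-- `w⁽⁰⁾(G)`: the multiset, over vertices `x`, of the closed walk-count functions
`k ↦ w_k(x,x)`. -/
noncomputable def wZeroC {V : Type*} [Fintype V] [DecidableEq V]
    (G : SimpleGraph V) : Multiset (ℕ → ℕ) :=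
  (Finset.univ : Finset V).val.map fun x => walkFunC G x x

/-- `w_k(G)`: the total number of `k`-walks in `G`. -/
noncomputable def totalWalksC {V : Type*} [Fintype V] [DecidableEq V]
    (G : SimpleGraph V) (k : ℕ) : ℕ :=
  ∑ x, ∑ y, walkFunC G x y k

/-- Neighbour lists of the first tree. -/
def nbOne : List (List (Fin 19)) :=
  [[1, 10, 13, 16], [0, 2], [1, 3, 9], [2, 4, 7, 8], [3, 5, 6], [4], [4], [3], [3], [2],
   [0, 11], [10, 12], [11], [0, 14], [13, 15], [14], [0, 17], [16, 18], [17]]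

/-- Neighbour lists of the second tree. -/
def nbTwo : List (List (Fin 19)) :=
  [[1, 10, 18], [0, 2], [1, 3, 6, 9], [2, 4], [3, 5], [4], [2, 7, 8], [6], [6], [2],
   [0, 11, 14, 17], [10, 12], [11, 13], [12], [10, 15], [14, 16], [15], [10], [0]]

/-- The neighbours of a vertex. -/
def nbOf (N : List (List (Fin 19))) (x : Fin 19) : List (Fin 19) := N.getD x.val []

/-- The validity conditions for neighbour lists of a tree rooted at `0`. -/
def GoodNb (N : List (List (Fin 19))) : Prop :=
  (∀ x, x ∉ nbOf N x) ∧ (∀ x, ∀ y ∈ nbOf N x, x ∈ nbOf N y) ∧ (∀ x, (nbOf N x).Nodup) ∧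
  (∀ x, x ≠ 0 → ∃ y ∈ nbOf N x, y < x) ∧ ∑ x, (nbOf N x).length = 36

instance (N : List (List (Fin 19))) : Decidable (GoodNb N) := by
  unfold GoodNb; infer_instance

theorem good_one : GoodNb nbOne := by decide +kernel
theorem good_two : GoodNb nbTwo := by decide +kernel

/-- The graph with the given neighbour lists. -/
def nbGraph (N : List (List (Fin 19))) (h : GoodNb N) : SimpleGraph (Fin 19) where
  Adj x y := y ∈ nbOf N x
  symm := ⟨fun x y hxy => h.2.1 x y hxy⟩
  loopless := ⟨fun x hx => h.1 x hx⟩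

theorem nbGraph_connected (N) (h : GoodNb N) : (nbGraph N h).Connected := by
  have key : ∀ n : ℕ, ∀ x : Fin 19, x.val = n → (nbGraph N h).Reachable x 0 := by
    intro n
    induction n using Nat.strong_induction_on with
    | _ n ih =>
      intro x hx
      by_cases h0 : x = 0
      · subst h0; exact SimpleGraph.Reachable.refl _
      · obtain ⟨y, hy, hlt⟩ := h.2.2.2.1 x h0
        have hadj : (nbGraph N h).Adj x y := hy
        exact hadj.reachable.trans (ih y.val (by omega) y rfl)
  have : Nonempty (Fin 19) := ⟨0⟩
  exact ⟨fun x y => (key _ x rfl).trans (key _ y rfl).symm⟩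

theorem nbGraph_isTree (N) (h : GoodNb N) : (nbGraph N h).IsTree := by
  classical
  rw [SimpleGraph.isTree_iff_connected_and_card]
  refine ⟨nbGraph_connected N h, ?_⟩
  have hs := (nbGraph N h).sum_degrees_eq_twice_card_edges
  have hd : ∀ x, (nbGraph N h).degree x = (nbOf N x).length := by
    intro x
    have hn : (nbGraph N h).neighborFinset x = (nbOf N x).toFinset := by
      ext y
      rw [SimpleGraph.mem_neighborFinset, List.mem_toFinset]
      exact Iff.rfl
    rw [← List.toFinset_card_of_nodup (h.2.2.1 x), ← SimpleGraph.card_neighborFinset_eq_degree, hn]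
  simp only [hd] at hs
  rw [h.2.2.2.2] at hs
  rw [Nat.card_eq_fintype_card, ← SimpleGraph.edgeFinset_card]
  simp
  omega

/-- One step of the walk recursion. -/
def stepL (N : List (List (Fin 19))) (v : List ℕ) : List ℕ :=
  N.map fun l => (l.map fun z => v.getD z.val 0).sum

/-- The row of `x` in the `k`-th power of the adjacency matrix, as a list. -/
def rowL (N : List (List (Fin 19))) (x : Fin 19) : ℕ → List ℕ
  | 0 => (List.finRange 19).map fun y => if x = y then 1 else 0
  | k + 1 => stepL N (rowL N x k)

theorem walk_succ (G : SimpleGraph (Fin 19)) [DecidableRel G.Adj] (x y : Fin 19) (k : ℕ) :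
    (G.adjMatrix ℕ ^ (k + 1)) x y = ∑ z ∈ G.neighborFinset y, (G.adjMatrix ℕ ^ k) x z := by
  rw [pow_succ, SimpleGraph.mul_adjMatrix_apply]

theorem walk_eq_row (N) (h : GoodNb N) (x : Fin 19) (k : ℕ) :
    ∀ y, walkFunC (nbGraph N h) x y k = (rowL N x k).getD y.val 0 := by
  classical
  induction k with
  | zero =>
    intro y
    simp [walkFunC, rowL, Matrix.one_apply]
  | succ k ih =>
    intro y
    have hstep : (rowL N x (k + 1)).getD y.val 0
        = ((nbOf N y).map fun z => (rowL N x k).getD z.val 0).sum := by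
      simp only [rowL, stepL, nbOf, List.getD_eq_getElem?_getD, List.getElem?_map]
      cases N[y.val]? <;> simp
    rw [hstep]
    simp only [← ih]
    rw [← List.sum_toFinset _ (h.2.2.1 y)]
    simp only [walkFunC]
    rw [walk_succ]
    refine Finset.sum_congr ?_ fun _ _ => rfl
    ext z
    rw [SimpleGraph.mem_neighborFinset, List.mem_toFinset]
    exact Iff.rfl

/-- Entrywise check of the annihilating polynomial. -/
def AnnL (N : List (List (Fin 19))) : Prop :=
  ∀ x y : Fin 19,
    (rowL N x 11).getD y.val 0 + 68 * (rowL N x 7).getD y.val 0 + 114 * (rowL N x 3).getD y.val 0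
    = 14 * (rowL N x 9).getD y.val 0 + 137 * (rowL N x 5).getD y.val 0
      + 32 * (rowL N x 1).getD y.val 0

instance (N : List (List (Fin 19))) : Decidable (AnnL N) := by
  unfold AnnL; infer_instance

theorem ann_one : AnnL nbOne := by decide +kernel
theorem ann_two : AnnL nbTwo := by decide +kernel

theorem walk_rec (N) (h : GoodNb N) (ha : AnnL N) (x y : Fin 19) (k : ℕ) :
    walkFunC (nbGraph N h) x y (k + 11) + 68 * walkFunC (nbGraph N h) x y (k + 7)
      + 114 * walkFunC (nbGraph N h) x y (k + 3)
    = 14 * walkFunC (nbGraph N h) x y (k + 9) + 137 * walkFunC (nbGraph N h) x y (k + 5)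
      + 32 * walkFunC (nbGraph N h) x y (k + 1) := by
  classical
  induction k generalizing y with
  | zero =>
    simp only [walk_eq_row, Nat.zero_add]
    exact ha x y
  | succ k ih =>
    have hs : ∀ j, walkFunC (nbGraph N h) x y (j + 1)
        = ∑ z ∈ (nbGraph N h).neighborFinset y, walkFunC (nbGraph N h) x z j := by
      intro j
      simp only [walkFunC]
      rw [walk_succ]
    have e : ∀ j, k + 1 + j = (k + j) + 1 := fun j => by omega
    simp only [e, hs, Finset.mul_sum, ← Finset.sum_add_distrib]
    exact Finset.sum_congr rfl fun z _ => ih z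

/-- The matching of vertices with equal closed walk counts. -/
def sigmaL : List (Fin 19) := [2, 1, 0, 10, 6, 7, 8, 9, 17, 18, 3, 4, 5, 11, 12, 13, 14, 15, 16]

/-- The inverse matching. -/
def sigmaInvL : List (Fin 19) :=
  [2, 1, 0, 10, 11, 12, 4, 5, 6, 7, 3, 13, 14, 15, 16, 17, 18, 8, 9]

/-- The matching as a permutation. -/
def sigmaE : Equiv.Perm (Fin 19) where
  toFun x := sigmaL.getD x.val 0
  invFun x := sigmaInvL.getD x.val 0
  left_inv := by unfold Function.LeftInverse; decide +kernel
  right_inv := by unfold Function.RightInverse Function.LeftInverse; decide +kernel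

theorem init_eq : ∀ x : Fin 19, ∀ k : Fin 12,
    (rowL nbOne x k.val).getD x.val 0 = (rowL nbTwo (sigmaE x) k.val).getD (sigmaE x).val 0 := by
  decide +kernel

theorem closed_eq (x : Fin 19) (k : ℕ) :
    walkFunC (nbGraph nbOne good_one) x x k
      = walkFunC (nbGraph nbTwo good_two) (sigmaE x) (sigmaE x) k := by
  induction k using Nat.strong_induction_on with
  | _ k ih =>
    by_cases hk : k < 12
    · rw [walk_eq_row, walk_eq_row]
      exact init_eq x ⟨k, hk⟩
    · obtain ⟨m, rfl⟩ : ∃ m, k = m + 11 := ⟨k - 11, by omega⟩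
      have h1 := walk_rec nbOne good_one ann_one x x m
      have h2 := walk_rec nbTwo good_two ann_two (sigmaE x) (sigmaE x) m
      have a7 := ih (m + 7) (by omega)
      have a3 := ih (m + 3) (by omega)
      have a9 := ih (m + 9) (by omega)
      have a5 := ih (m + 5) (by omega)
      have a1 := ih (m + 1) (by omega)
      omega

/-- There exist trees `T`, `T'` on 19 vertices (finite connected
acyclic simple graphs) with `w⁽⁰⁾(T) = w⁽⁰⁾(T')` (the same eigenvalues and angles)
but `w_k(T) ≠ w_k(T')` for some `k`: the eigenvalue–angle invariant does not
determine the main eigenvalues and main angles. -/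
theorem exists_trees_wZero_eq_totalWalks_ne :
    ∃ (T T' : SimpleGraph (Fin 19)),
      T.Connected ∧ T.IsAcyclic ∧ T'.Connected ∧ T'.IsAcyclic ∧
      wZeroC T = wZeroC T' ∧ ∃ k : ℕ, totalWalksC T k ≠ totalWalksC T' k := by
  refine ⟨nbGraph nbOne good_one, nbGraph nbTwo good_two, nbGraph_connected _ _,
    (nbGraph_isTree _ _).isAcyclic, nbGraph_connected _ _, (nbGraph_isTree _ _).isAcyclic, ?_, 6, ?_⟩
  · have h : (fun x => walkFunC (nbGraph nbOne good_one) x x)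
        = (fun x => walkFunC (nbGraph nbTwo good_two) x x) ∘ sigmaE := by
      funext x k
      exact closed_eq x k
    unfold wZeroC
    rw [h, ← Multiset.map_map, Multiset.map_univ_val_equiv]
  · simp only [totalWalksC, walk_eq_row]
    decide +kernel
end
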